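/- arXiv:1011.2479 — 2 statements merged into one kernel-verified Lean document; each statement's English description precedes it below -/
import Mathlib

section
/- Let α, β, γ ∈ ℂ with α + β + γ = 0, γ ≠ 0, let m be a positive integer, let a₄, a₅, a₆, a₈, a₉, a₁₀, C ∈ ℂ with a₆ ≠ 0, 2a₄a₇ − a₈a₁₀ ≠ 0, 2a₄a₉ − a₆a₈ ≠ 0, a₆a₁₀ − 2a₄a₅ ≠ 0, and define a₇, a₁, a₂, a₃ by a₇ = −(αa₅a₈ + βa₉a₁₀)/(γa₆), a₁ = [a₆(αa₉a₁₀ + βa₅a₈) + 2γa₄a₅a₉]/[2γ(2a₄a₇ − a₈a₁₀)], a₂ = [αa₁₀(a₅a₈ − a₉a₁₀) + γa₅(2a₄a₇ − a₈a₁₀)]/[2γ(2a₄a₉ − a₆a₈)], a₃ = [βa₈(a₅a₈ − a₉a₁₀) − γa₉(2a₄a₇ − a₈a₁₀)]/[2γ(a₆a₁₀ − 2a₄a₅)]. Then the polynomial P(z) = a₁(z¹)^{2m} + a₂(z²)^{2m} + a₃(z³)^{2m} + a₄(z⁴)^{2m} + a₅(z¹)^m(z²)^m + a₆(z¹)^m(z⁴)^m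 + a₇(z²)^m(z³)^m + a₈(z³)^m(z⁴)^m + a₉(z¹)^m(z³)^m + a₁₀(z²)^m(z⁴)^m + C satisfies both the general heavenly equation αP_{12}P_{34} + βP_{13}P_{24} + γP_{14}P_{23} = 0 and the differential constraint α(P₁P₂P_{34} + P₃P₄P_{12}) + β(P₁P₃P_{24} + P₂P₄P_{13}) + γ(P₁P₄P_{23} + P₂P₃P_{14}) = 0 on ℂ⁴ (away from the coordinate hyperplanes when m > 1, so that the powers are smooth). -/
/-!  Coordinates: `z : Fin 4 → ℂ` with paper indices `z¹,z²,z³,z⁴` corresponding to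
`z 0, z 1, z 2, z 3`.  `pd i f` is the partial derivative ∂f/∂zⁱ. -/

/-- Partial derivative of `f : ℂ⁴ → ℂ` in the `i`-th coordinate direction. -/
noncomputable def pd (i : Fin 4) (f : (Fin 4 → ℂ) → ℂ) : (Fin 4 → ℂ) → ℂ :=
  fun z => fderiv ℂ f z (Pi.single i 1)

/-- The polynomial `Q(z) = a₁(z¹)^{2m} + a₂(z²)^{2m} + a₃(z³)^{2m} + a₄(z⁴)^{2m}
+ a₅(z¹)^m(z²)^m + a₆(z¹)^m(z⁴)^m + a₇(z²)^m(z³)^m + a₈(z³)^m(z⁴)^m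
+ a₉(z¹)^m(z³)^m + a₁₀(z²)^m(z⁴)^m + C`. -/
noncomputable def Qpoly (m : ℕ) (a1 a2 a3 a4 a5 a6 a7 a8 a9 a10 C : ℂ)
    (z : Fin 4 → ℂ) : ℂ :=
  a1 * (z 0) ^ (2 * m) + a2 * (z 1) ^ (2 * m) + a3 * (z 2) ^ (2 * m) + a4 * (z 3) ^ (2 * m)
    + a5 * (z 0) ^ m * (z 1) ^ m + a6 * (z 0) ^ m * (z 3) ^ m
    + a7 * (z 1) ^ m * (z 2) ^ m + a8 * (z 2) ^ m * (z 3) ^ m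
    + a9 * (z 0) ^ m * (z 2) ^ m + a10 * (z 1) ^ m * (z 3) ^ m + C

lemma pd_add' (i : Fin 4) (f g : (Fin 4 → ℂ) → ℂ) (hf : Differentiable ℂ f) (hg : Differentiable ℂ g) (z) :
    pd i (fun z => f z + g z) z = pd i f z + pd i g z := by
  simp only [pd]
  rw [fderiv_fun_add (hf z) (hg z)]; rfl

lemma pd_mul' (i : Fin 4) (f g : (Fin 4 → ℂ) → ℂ) (hf : Differentiable ℂ f) (hg : Differentiable ℂ g) (z) :
    pd i (fun z => f z * g z) z = f z * pd i g z + g z * pd i f z := by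
  simp only [pd]
  rw [fderiv_fun_mul (hf z) (hg z)]; rfl

lemma pd_const' (i : Fin 4) (c : ℂ) (z) : pd i (fun _ => c) z = 0 := by
  simp [pd]

lemma pd_coord' (i j : Fin 4) (n : ℕ) (z : Fin 4 → ℂ) :
    pd i (fun z => z j ^ n) z = (n * z j ^ (n - 1)) * (if j = i then 1 else 0) := by
  have h : HasFDerivAt (fun z : Fin 4 → ℂ => z j) (ContinuousLinearMap.proj j : (Fin 4 → ℂ) →L[ℂ] ℂ) z :=
    hasFDerivAt_apply j z
  have := (h.pow n).fderiv
  simp only [pd]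
  rw [this]
  simp [Pi.single_apply]

/-- linear form `q_j` of the quadratic form. -/
lemma pd_Q (j : Fin 4) (k : ℕ) (a1 a2 a3 a4 a5 a6 a7 a8 a9 a10 C : ℂ) :
    pd j (Qpoly (k+1) a1 a2 a3 a4 a5 a6 a7 a8 a9 a10 C) = fun z =>
      (((k:ℂ)+1) * z j ^ k) *
      ((![2*a1, a5, a9, a6] j) * z 0 ^ (k+1) + (![a5, 2*a2, a7, a10] j) * z 1 ^ (k+1)
      + (![a9, a7, 2*a3, a8] j) * z 2 ^ (k+1) + (![a6, a10, a8, 2*a4] j) * z 3 ^ (k+1)) := by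
  funext z
  unfold Qpoly
  simp (disch := fun_prop) only [pd_add', pd_mul', pd_const', pd_coord']
  have e : 2 * (k+1) - 1 = 2*k+1 := by omega
  rw [e]
  fin_cases j <;> simp <;> ring

lemma pd_Q2 (i j : Fin 4) (hij : i ≠ j) (k : ℕ) (a1 a2 a3 a4 a5 a6 a7 a8 a9 a10 C : ℂ) (z) :
    pd i (pd j (Qpoly (k+1) a1 a2 a3 a4 a5 a6 a7 a8 a9 a10 C)) z =
      (((k:ℂ)+1) * z j ^ k) * (((k:ℂ)+1) * z i ^ k) *
      (![![2*a1, a5, a9, a6] j, ![a5, 2*a2, a7, a10] j, ![a9, a7, 2*a3, a8] j,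
        ![a6, a10, a8, 2*a4] j] i) := by
  rw [pd_Q]
  simp (disch := fun_prop) only [pd_add', pd_mul', pd_const', pd_coord']
  simp only [if_neg hij.symm]
  fin_cases i <;> simp <;> ring

lemma quad (α β γ : ℂ) (hαβγ : α + β + γ = 0) (hγ : γ ≠ 0)
    (a1 a2 a3 a4 a5 a6 a7 a8 a9 a10 : ℂ)
    (ha6 : a6 ≠ 0)
    (ha7 : a7 = -(α * a5 * a8 + β * a9 * a10) / (γ * a6))
    (hd1 : 2 * a4 * a7 - a8 * a10 ≠ 0)
    (hd2 : 2 * a4 * a9 - a6 * a8 ≠ 0)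
    (hd3 : a6 * a10 - 2 * a4 * a5 ≠ 0)
    (ha1 : a1 = (a6 * (α * a9 * a10 + β * a5 * a8) + 2 * γ * a4 * a5 * a9)
      / (2 * γ * (2 * a4 * a7 - a8 * a10)))
    (ha2 : a2 = (α * a10 * (a5 * a8 - a9 * a10) + γ * a5 * (2 * a4 * a7 - a8 * a10))
      / (2 * γ * (2 * a4 * a9 - a6 * a8)))
    (ha3 : a3 = (β * a8 * (a5 * a8 - a9 * a10) - γ * a9 * (2 * a4 * a7 - a8 * a10))
      / (2 * γ * (a6 * a10 - 2 * a4 * a5))) (x y z w p q r s : ℂ)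
    (hp : p = 2*a1*x+a5*y+a9*z+a6*w) (hq : q = a5*x+2*a2*y+a7*z+a10*w)
    (hr : r = a9*x+a7*y+2*a3*z+a8*w) (hs : s = a6*x+a10*y+a8*z+2*a4*w) :
    α * (p*q*a8+r*s*a5) + β * (p*r*a10+q*s*a9) + γ * (p*s*a7+q*r*a6) = 0 := by
  obtain rfl : α = -β-γ := by linear_combination hαβγ
  obtain ⟨D, hD⟩ : ∃ D, D = 2*a4*(-((-β-γ) * a5 * a8 + β * a9 * a10)) - γ*a6*a8*a10 := ⟨_, rfl⟩
  have hd : 2 * a4 * a7 - a8 * a10 = D / (γ*a6) := by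
    rw [ha7, hD]; field_simp
  have hD0 : D ≠ 0 := by
    rintro h; apply hd1; rw [hd, h]; simp
  rw [hd] at ha1 ha2 ha3
  obtain ⟨d2, hd2'⟩ : ∃ D, D = 2 * a4 * a9 - a6 * a8 := ⟨_, rfl⟩
  obtain ⟨d3, hd3'⟩ : ∃ D, D = a6 * a10 - 2 * a4 * a5 := ⟨_, rfl⟩
  rw [← hd2'] at ha2 hd2
  rw [← hd3'] at ha3 hd3
  have c11 : (-β-γ) * (2*a1*a5*a8+a9*a6*a5) + β * (2*a1*a9*a10+a5*a6*a9) + γ * (2*a1*a6*a7+a5*a9*a6) = 0 := by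
    rw [ha7]; field_simp; ring
  have c22 : (-β-γ) * (a5*2*a2*a8+a7*a10*a5) + β * (a5*a7*a10+2*a2*a10*a9) + γ * (a5*a10*a7+2*a2*a7*a6) = 0 := by
    rw [ha7]; field_simp; ring
  have c33 : (-β-γ) * (a9*a7*a8+2*a3*a8*a5) + β * (a9*2*a3*a10+a7*a8*a9) + γ * (a9*a8*a7+a7*2*a3*a6) = 0 := by
    rw [ha7]; field_simp; ring
  have c44 : (-β-γ) * (a6*a10*a8+a8*2*a4*a5) + β * (a6*a8*a10+a10*2*a4*a9) + γ * (a6*2*a4*a7+a10*a8*a6) = 0 := by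
    rw [ha7]; field_simp; ring
  have c12 : (-β-γ) * ((2*a1*(2*a2)+a5*a5)*a8+(a9*a10+a7*a6)*a5) + β * ((2*a1*a7+a5*a9)*a10+(a5*a10+2*a2*a6)*a9) + γ * ((2*a1*a10+a5*a6)*a7+(a5*a7+2*a2*a9)*a6) = 0 := by
    rw [ha1,ha2,ha7]; field_simp; rw [hD,hd2']; ring
  have c13 : (-β-γ) * ((2*a1*a7+a9*a5)*a8+(a9*a8+2*a3*a6)*a5) + β * ((2*a1*(2*a3)+a9*a9)*a10+(a5*a8+a7*a6)*a9) + γ * ((2*a1*a8+a9*a6)*a7+(a5*(2*a3)+a7*a9)*a6) = 0 := by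
    rw [ha1,ha3,ha7]; field_simp; rw [hD,hd3']; ring
  have c14 : (-β-γ) * ((2*a1*a10+a6*a5)*a8+(a9*(2*a4)+a8*a6)*a5) + β * ((2*a1*a8+a6*a9)*a10+(a5*(2*a4)+a10*a6)*a9) + γ * ((2*a1*(2*a4)+a6*a6)*a7+(a5*a8+a10*a9)*a6) = 0 := by
    rw [ha1,ha7]; field_simp; rw [hD]; ring
  have c23 : (-β-γ) * ((a5*a7+a9*(2*a2))*a8+(a7*a8+2*a3*a10)*a5) + β * ((a5*(2*a3)+a9*a7)*a10+(2*a2*a8+a7*a10)*a9) + γ * ((a5*a8+a9*a10)*a7+(2*a2*(2*a3)+a7*a7)*a6) = 0 := by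
    rw [ha2,ha3,ha7]; field_simp; rw [hD,hd2',hd3']; ring
  have c24 : (-β-γ) * ((a5*a10+a6*(2*a2))*a8+(a7*(2*a4)+a8*a10)*a5) + β * ((a5*a8+a6*a7)*a10+(2*a2*(2*a4)+a10*a10)*a9) + γ * ((a5*(2*a4)+a6*a10)*a7+(2*a2*a8+a10*a7)*a6) = 0 := by
    rw [ha2,ha7]; field_simp; rw [hD,hd2']; ring
  have c34 : (-β-γ) * ((a9*a10+a6*a7)*a8+(2*a3*(2*a4)+a8*a8)*a5) + β * ((a9*a8+a6*(2*a3))*a10+(a7*(2*a4)+a10*a8)*a9) + γ * ((a9*(2*a4)+a6*a8)*a7+(a7*a8+a10*(2*a3))*a6) = 0 := by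
    rw [ha3,ha7]; field_simp; rw [hD,hd3']; ring
  rw [hp,hq,hr,hs]
  clear ha1 ha2 ha3 ha7 hd1 hd2 hd3 hd hD hd2' hd3'
  linear_combination x^2*c11+y^2*c22+z^2*c33+w^2*c44+x*y*c12+x*z*c13+x*w*c14+y*z*c23+y*w*c24+z*w*c34

/-- the polynomial `P = Q` with coefficients from the first family
(\ref{sol1}) satisfies both the general heavenly equation and the differential
constraint (\ref{difcon}) on ℂ⁴ (away from the coordinate hyperplanes when `m > 1`). -/
theorem polynomial_satisfies_equation_and_constraint
    (α β γ : ℂ) (hαβγ : α + β + γ = 0) (hγ : γ ≠ 0)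
    (m : ℕ) (hm : 0 < m)
    (a1 a2 a3 a4 a5 a6 a7 a8 a9 a10 C : ℂ)
    (ha6 : a6 ≠ 0)
    (ha7 : a7 = -(α * a5 * a8 + β * a9 * a10) / (γ * a6))
    (hd1 : 2 * a4 * a7 - a8 * a10 ≠ 0)
    (hd2 : 2 * a4 * a9 - a6 * a8 ≠ 0)
    (hd3 : a6 * a10 - 2 * a4 * a5 ≠ 0)
    (ha1 : a1 = (a6 * (α * a9 * a10 + β * a5 * a8) + 2 * γ * a4 * a5 * a9)
      / (2 * γ * (2 * a4 * a7 - a8 * a10)))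
    (ha2 : a2 = (α * a10 * (a5 * a8 - a9 * a10) + γ * a5 * (2 * a4 * a7 - a8 * a10))
      / (2 * γ * (2 * a4 * a9 - a6 * a8)))
    (ha3 : a3 = (β * a8 * (a5 * a8 - a9 * a10) - γ * a9 * (2 * a4 * a7 - a8 * a10))
      / (2 * γ * (a6 * a10 - 2 * a4 * a5))) :
    ∀ z : Fin 4 → ℂ, (1 < m → ∀ i : Fin 4, z i ≠ 0) →
      (α * pd 0 (pd 1 (Qpoly m a1 a2 a3 a4 a5 a6 a7 a8 a9 a10 C)) z
          * pd 2 (pd 3 (Qpoly m a1 a2 a3 a4 a5 a6 a7 a8 a9 a10 C)) z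
        + β * pd 0 (pd 2 (Qpoly m a1 a2 a3 a4 a5 a6 a7 a8 a9 a10 C)) z
          * pd 1 (pd 3 (Qpoly m a1 a2 a3 a4 a5 a6 a7 a8 a9 a10 C)) z
        + γ * pd 0 (pd 3 (Qpoly m a1 a2 a3 a4 a5 a6 a7 a8 a9 a10 C)) z
          * pd 1 (pd 2 (Qpoly m a1 a2 a3 a4 a5 a6 a7 a8 a9 a10 C)) z = 0)
      ∧
      (α * (pd 0 (Qpoly m a1 a2 a3 a4 a5 a6 a7 a8 a9 a10 C) z
              * pd 1 (Qpoly m a1 a2 a3 a4 a5 a6 a7 a8 a9 a10 C) z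
              * pd 2 (pd 3 (Qpoly m a1 a2 a3 a4 a5 a6 a7 a8 a9 a10 C)) z
            + pd 2 (Qpoly m a1 a2 a3 a4 a5 a6 a7 a8 a9 a10 C) z
              * pd 3 (Qpoly m a1 a2 a3 a4 a5 a6 a7 a8 a9 a10 C) z
              * pd 0 (pd 1 (Qpoly m a1 a2 a3 a4 a5 a6 a7 a8 a9 a10 C)) z)
        + β * (pd 0 (Qpoly m a1 a2 a3 a4 a5 a6 a7 a8 a9 a10 C) z
              * pd 2 (Qpoly m a1 a2 a3 a4 a5 a6 a7 a8 a9 a10 C) z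
              * pd 1 (pd 3 (Qpoly m a1 a2 a3 a4 a5 a6 a7 a8 a9 a10 C)) z
            + pd 1 (Qpoly m a1 a2 a3 a4 a5 a6 a7 a8 a9 a10 C) z
              * pd 3 (Qpoly m a1 a2 a3 a4 a5 a6 a7 a8 a9 a10 C) z
              * pd 0 (pd 2 (Qpoly m a1 a2 a3 a4 a5 a6 a7 a8 a9 a10 C)) z)
        + γ * (pd 0 (Qpoly m a1 a2 a3 a4 a5 a6 a7 a8 a9 a10 C) z
              * pd 3 (Qpoly m a1 a2 a3 a4 a5 a6 a7 a8 a9 a10 C) z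
              * pd 1 (pd 2 (Qpoly m a1 a2 a3 a4 a5 a6 a7 a8 a9 a10 C)) z
            + pd 1 (Qpoly m a1 a2 a3 a4 a5 a6 a7 a8 a9 a10 C) z
              * pd 2 (Qpoly m a1 a2 a3 a4 a5 a6 a7 a8 a9 a10 C) z
              * pd 0 (pd 3 (Qpoly m a1 a2 a3 a4 a5 a6 a7 a8 a9 a10 C)) z) = 0) := by
  intro z _
  obtain ⟨k, rfl⟩ : ∃ k, m = k + 1 := ⟨m - 1, by omega⟩
  have h7 : γ * a6 * a7 = -(α * a5 * a8 + β * a9 * a10) := by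
    rw [ha7]; field_simp
  have hq := quad α β γ hαβγ hγ a1 a2 a3 a4 a5 a6 a7 a8 a9 a10 ha6 ha7 hd1 hd2 hd3 ha1 ha2 ha3
    (z 0 ^ (k+1)) (z 1 ^ (k+1)) (z 2 ^ (k+1)) (z 3 ^ (k+1)) _ _ _ _ rfl rfl rfl rfl
  rw [pd_Q2 0 1 (by decide), pd_Q2 2 3 (by decide), pd_Q2 0 2 (by decide), pd_Q2 1 3 (by decide),
    pd_Q2 0 3 (by decide), pd_Q2 1 2 (by decide)]
  simp only [pd_Q]
  simp only [Matrix.cons_val]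
  clear ha1 ha2 ha3 ha7 hd1 hd2 hd3
  generalize z 0 ^ (k+1) = X at *
  generalize z 1 ^ (k+1) = Y at *
  generalize z 2 ^ (k+1) = Z at *
  generalize z 3 ^ (k+1) = W at *
  generalize ((k:ℂ)+1) = n
  generalize z 0 ^ k = x
  generalize z 1 ^ k = y
  generalize z 2 ^ k = u
  generalize z 3 ^ k = w
  constructor
  · linear_combination (n^4*x*y*u*w) * h7
  · linear_combination (n^4*x*y*u*w) * hq
end

section
/- Let β, γ ∈ ℂ and let u be three times continuously differentiable on an open set U ⊆ ℂ⁴ with u_{34} ≠ 0 on U, satisfying the general heavenly equation (β+γ)u_{12}u_{34} = βu_{13}u_{24} + γu_{14}u_{23} on U. Define the four vector fields e_{00'} = ∂₁ − (u_{13}/u_{34})∂₄, e_{10'} = −∂₂ + (u_{23}/u_{34})∂₄, e_{01'} = −γ(∂₁ − (u_{14}/u_{34})∂₃), e_{11'} = −β(∂₂ − (u_{24}/u_{34})∂₃). Then, as operators on twice continuously differentiable functions on U, [e_{00'}, e_{10'}] = 0, [e_{01'}, e_{11'}] = 0, and [e_{00'}, e_{11'}] + [e_{01'}, e_{10'}]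 = 0. -/
/-- `e_{00'} = ∂₁ − (u₁₃/u₃₄)∂₄` acting on functions. -/
noncomputable def e00 (u f : (Fin 4 → ℂ) → ℂ) : (Fin 4 → ℂ) → ℂ :=
  fun z => pd 0 f z - pd 0 (pd 2 u) z / pd 2 (pd 3 u) z * pd 3 f z

/-- `e_{10'} = −∂₂ + (u₂₃/u₃₄)∂₄` acting on functions. -/
noncomputable def e10 (u f : (Fin 4 → ℂ) → ℂ) : (Fin 4 → ℂ) → ℂ :=
  fun z => -pd 1 f z + pd 1 (pd 2 u) z / pd 2 (pd 3 u) z * pd 3 f z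

/-- `e_{01'} = −γ(∂₁ − (u₁₄/u₃₄)∂₃)` acting on functions. -/
noncomputable def e01 (γ : ℂ) (u f : (Fin 4 → ℂ) → ℂ) : (Fin 4 → ℂ) → ℂ :=
  fun z => -γ * (pd 0 f z - pd 0 (pd 3 u) z / pd 2 (pd 3 u) z * pd 2 f z)

/-- `e_{11'} = −β(∂₂ − (u₂₄/u₃₄)∂₃)` acting on functions. -/
noncomputable def e11 (β : ℂ) (u f : (Fin 4 → ℂ) → ℂ) : (Fin 4 → ℂ) → ℂ :=
  fun z => -β * (pd 1 f z - pd 1 (pd 3 u) z / pd 2 (pd 3 u) z * pd 2 f z)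

theorem pd_contDiffOn {U : Set (Fin 4 → ℂ)} (hU : IsOpen U) {g : (Fin 4 → ℂ) → ℂ} {m n : WithTop ℕ∞}
    (hg : ContDiffOn ℂ n g U) (hmn : m + 1 ≤ n) (i : Fin 4) : ContDiffOn ℂ m (pd i g) U :=
  (hg.fderiv_of_isOpen hU hmn).clm_apply contDiffOn_const

theorem pd_comm {U : Set (Fin 4 → ℂ)} (hU : IsOpen U) {g : (Fin 4 → ℂ) → ℂ}
    (hg : ContDiffOn ℂ 2 g U) (i j : Fin 4) {z : Fin 4 → ℂ} (hz : z ∈ U) :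
    pd i (pd j g) z = pd j (pd i g) z := by
  have hd : DifferentiableAt ℂ (fderiv ℂ g) z :=
    ((hg.fderiv_of_isOpen (m := 1) hU (by norm_num)).differentiableOn (by norm_num)).differentiableAt
      (hU.mem_nhds hz)
  have key : ∀ a b : Fin 4, pd a (pd b g) z
      = fderiv ℂ (fderiv ℂ g) z (Pi.single a 1) (Pi.single b 1) := by
    intro a b
    unfold pd
    rw [fderiv_clm_apply hd (differentiableAt_const _)]
    simp
  rw [key, key]
  have hc : ContDiffAt ℂ 2 g z := hg.contDiffAt (hU.mem_nhds hz)
  exact (hc.isSymmSndFDerivAt (by simp)).eq _ _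

theorem pd_congr {U : Set (Fin 4 → ℂ)} (hU : IsOpen U) {g h : (Fin 4 → ℂ) → ℂ}
    (hgh : ∀ z ∈ U, g z = h z) (i : Fin 4) {z : Fin 4 → ℂ} (hz : z ∈ U) :
    pd i g z = pd i h z := by
  have : g =ᶠ[nhds z] h := Filter.eventuallyEq_of_mem (hU.mem_nhds hz) hgh
  unfold pd
  rw [this.fderiv_eq]

theorem pd_add {p q : (Fin 4 → ℂ) → ℂ} {z : Fin 4 → ℂ} (hp : DifferentiableAt ℂ p z)
    (hq : DifferentiableAt ℂ q z) (i : Fin 4) :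
    pd i (fun w => p w + q w) z = pd i p z + pd i q z := by
  unfold pd
  rw [fderiv_fun_add hp hq]; rfl

theorem pd_tri (c : ℂ) {p q : (Fin 4 → ℂ) → ℂ} {z : Fin 4 → ℂ} (hp : DifferentiableAt ℂ p z)
    (hq : DifferentiableAt ℂ q z) (i : Fin 4) :
    pd i (fun w => c * p w * q w) z = c * (pd i p z * q z + p z * pd i q z) := by
  unfold pd
  refine (congrArg (fun L => L (Pi.single i 1))
    ((hp.hasFDerivAt.const_mul c).mul hq.hasFDerivAt).fderiv).trans ?_
  simp
  ring

theorem pd_op (c : ℂ) {p q r s : (Fin 4 → ℂ) → ℂ} {z : Fin 4 → ℂ} (hp : DifferentiableAt ℂ p z)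
    (hq : DifferentiableAt ℂ q z) (hr : DifferentiableAt ℂ r z) (hs : DifferentiableAt ℂ s z)
    (h0 : s z ≠ 0) (i : Fin 4) :
    pd i (fun w => c * (p w - q w / s w * r w)) z
      = c * (pd i p z - ((pd i q z * s z - q z * pd i s z) / s z ^ 2 * r z
        + q z / s z * pd i r z)) := by
  have hinv := (hasDerivAt_inv h0).comp_hasFDerivAt z hs.hasFDerivAt
  have := ((hp.hasFDerivAt.sub ((hq.hasFDerivAt.mul hinv).mul hr.hasFDerivAt)).const_mul c).fderiv
  unfold pd
  simp only [div_eq_mul_inv]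
  refine (congrArg (fun L => L (Pi.single i 1)) this).trans ?_
  simp only [ContinuousLinearMap.smul_apply, ContinuousLinearMap.sub_apply,
    ContinuousLinearMap.add_apply, smul_eq_mul, Pi.mul_apply, Function.comp]
  field_simp
  ring

/-- on solutions of `(β+γ)u₁₂u₃₄ = βu₁₃u₂₄ + γu₁₄u₂₃` with `u₃₄ ≠ 0`, the
vector fields `e_{AA'}` satisfy `[e_{00'},e_{10'}] = 0`, `[e_{01'},e_{11'}] = 0` and
`[e_{00'},e_{11'}] + [e_{01'},e_{10'}] = 0` as operators on C² functions. -/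
theorem spinor_frame_commutators
    (β γ : ℂ)
    (U : Set (Fin 4 → ℂ)) (hU : IsOpen U)
    (u : (Fin 4 → ℂ) → ℂ) (hu : ContDiffOn ℂ 3 u U)
    (h34 : ∀ z ∈ U, pd 2 (pd 3 u) z ≠ 0)
    (heav : ∀ z ∈ U, (β + γ) * pd 0 (pd 1 u) z * pd 2 (pd 3 u) z
      = β * pd 0 (pd 2 u) z * pd 1 (pd 3 u) z + γ * pd 0 (pd 3 u) z * pd 1 (pd 2 u) z) :
    ∀ f : (Fin 4 → ℂ) → ℂ, ContDiffOn ℂ 2 f U → ∀ z ∈ U,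
      (e00 u (e10 u f) z - e10 u (e00 u f) z = 0) ∧
      (e01 γ u (e11 β u f) z - e11 β u (e01 γ u f) z = 0) ∧
      ((e00 u (e11 β u f) z - e11 β u (e00 u f) z)
        + (e01 γ u (e10 u f) z - e10 u (e01 γ u f) z) = 0) := by
  intro f hf z hz
  have hn := hU.mem_nhds hz
  have u1 : ∀ i, ContDiffOn ℂ 2 (pd i u) U := fun i => pd_contDiffOn hU hu (by norm_num) i
  have u2 : ∀ i j, DifferentiableAt ℂ (pd i (pd j u)) z := fun i j =>
    ((pd_contDiffOn (m := 1) hU (u1 j) (by norm_num) i).differentiableOn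
      (by norm_num)).differentiableAt hn
  have f1 : ∀ i, DifferentiableAt ℂ (pd i f) z := fun i =>
    ((pd_contDiffOn (m := 1) hU hf (by norm_num) i).differentiableOn
      (by norm_num)).differentiableAt hn
  have C : ∀ i j, pd i (pd j f) z = pd j (pd i f) z := fun i j => pd_comm hU hf i j hz
  have S : ∀ i j k, pd i (pd j (pd k u)) z = pd j (pd i (pd k u)) z :=
    fun i j k => pd_comm hU (u1 k) i j hz
  have R : ∀ j k i, pd i (pd j (pd k u)) z = pd i (pd k (pd j u)) z :=
    fun j k i => pd_congr hU
      (fun w hw => pd_comm hU (hu.of_le (by norm_num)) j k hw) i hz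
  have H0 := h34 z hz
  have E := heav z hz
  have D : ∀ i, (β + γ) * (pd i (pd 0 (pd 1 u)) z * pd 2 (pd 3 u) z
        + pd 0 (pd 1 u) z * pd i (pd 2 (pd 3 u)) z)
      = β * (pd i (pd 0 (pd 2 u)) z * pd 1 (pd 3 u) z
        + pd 0 (pd 2 u) z * pd i (pd 1 (pd 3 u)) z)
      + γ * (pd i (pd 0 (pd 3 u)) z * pd 1 (pd 2 u) z
        + pd 0 (pd 3 u) z * pd i (pd 1 (pd 2 u)) z) := by
    intro i
    have := pd_congr hU heav i hz
    have d : ∀ (c : ℂ) (a b k l : Fin 4),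
        DifferentiableAt ℂ (fun w => c * pd a (pd b u) w * pd k (pd l u) w) z :=
      fun c a b k l => ((u2 a b).const_mul c).mul (u2 k l)
    rw [pd_tri _ (u2 _ _) (u2 _ _), pd_add (d β 0 2 1 3) (d γ 0 3 1 2), pd_tri _ (u2 _ _) (u2 _ _),
      pd_tri _ (u2 _ _) (u2 _ _)] at this
    exact this
  have e00' : e00 u f = fun w => 1 * (pd 0 f w - pd 0 (pd 2 u) w / pd 2 (pd 3 u) w * pd 3 f w) := by
    funext w; unfold e00; ring
  have e10' : e10 u f = fun w => (-1) * (pd 1 f w - pd 1 (pd 2 u) w / pd 2 (pd 3 u) w * pd 3 f w) := by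
    funext w; unfold e10; ring
  have P00 : ∀ i, pd i (e00 u f) z = _ := fun i => by
    rw [e00', pd_op _ (f1 _) (u2 _ _) (f1 _) (u2 _ _) H0]
  have P10 : ∀ i, pd i (e10 u f) z = _ := fun i => by
    rw [e10', pd_op _ (f1 _) (u2 _ _) (f1 _) (u2 _ _) H0]
  have P01 : ∀ i, pd i (e01 γ u f) z = _ := fun i =>
    pd_op (-γ) (f1 0) (u2 0 3) (f1 2) (u2 2 3) H0 i
  have P11 : ∀ i, pd i (e11 β u f) z = _ := fun i =>
    pd_op (-β) (f1 1) (u2 1 3) (f1 2) (u2 2 3) H0 i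
  have D2 := D 2
  have D3 := D 3
  have X00 : ∀ g, e00 u g z = pd 0 g z - pd 0 (pd 2 u) z / pd 2 (pd 3 u) z * pd 3 g z := fun _ => rfl
  have X10 : ∀ g, e10 u g z = -pd 1 g z + pd 1 (pd 2 u) z / pd 2 (pd 3 u) z * pd 3 g z := fun _ => rfl
  have X01 : ∀ g, e01 γ u g z
    = -γ * (pd 0 g z - pd 0 (pd 3 u) z / pd 2 (pd 3 u) z * pd 2 g z) := fun _ => rfl
  have X11 : ∀ g, e11 β u g z
    = -β * (pd 1 g z - pd 1 (pd 3 u) z / pd 2 (pd 3 u) z * pd 2 g z) := fun _ => rfl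
  rw [X00, X10, X01, X11, X00, X11, X01, X10]
  simp only [P00, P10, P01, P11]
  simp only [C 1 0, C 2 0, C 3 0, C 2 1, C 3 1, C 3 2, S 1 0, S 2 0, S 3 0, S 2 1, S 3 1, S 3 2,
    R 1 0, R 2 0, R 3 0, R 2 1, R 3 1, R 3 2] at D2 D3 ⊢
  clear P00 P10 P01 P11 X00 X10 X01 X11 C S R D e00' e10' u1 u2 f1
  generalize pd 2 (pd 3 u) z = s at *
  generalize pd 0 (pd 1 u) z = u01 at *
  generalize pd 0 (pd 2 u) z = u02 at *
  generalize pd 0 (pd 3 u) z = u03 at *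
  generalize pd 1 (pd 2 u) z = u12 at *
  generalize pd 1 (pd 3 u) z = u13 at *
  refine ⟨?_, ?_, ?_⟩
  · field_simp
    ring
  · field_simp
    ring
  · field_simp
    linear_combination (-1) * pd 3 f z * (s * D2 - pd 2 (pd 2 (pd 3 u)) z * E)
      + pd 2 f z * (s * D3 - pd 2 (pd 3 (pd 3 u)) z * E)
end
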